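/- Let n, r ≥ 2 be integers and let (x_1,…,x_r) ∈ N_n^r. Then the (not necessarily unital) associative k-subalgebra ⟨x_1,…,x_r⟩ of Mat_n(k) generated by x_1,…,x_r is contained in a commutative (not necessarily unital) k-subalgebra of Mat_n(k) of dimension n − 1; in particular, dim ⟨x_1,…,x_r⟩ ≤ n − 1. -/

import Mathlib

open MvPolynomial Matrix TopologicalSpace

/-- The Zariski topology on `r`-tuples of `n × n` matrices over `k`, identified with
affine space `k^(r·n²)`: the topology generated by complements of hypersurfaces
(its closed sets are exactly the common zero loci of families of polynomials in the
matrix entries). -/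
noncomputable def matTupleZariski (k : Type*) [CommRing k] (n r : ℕ) :
    TopologicalSpace (Fin r → Matrix (Fin n) (Fin n) k) :=
  TopologicalSpace.generateFrom
    {U | ∃ p : MvPolynomial (Fin r × Fin n × Fin n) k,
      U = {x | MvPolynomial.eval (fun q => x q.1 q.2.1 q.2.2) p ≠ 0}}

/-- `C_r(N_n)`: the set of commuting `r`-tuples of nilpotent `n × n` matrices. -/
def nilCommTuples (k : Type*) [Field k] (n r : ℕ) :
    Set (Fin r → Matrix (Fin n) (Fin n) k) :=
  {x | (∀ i, IsNilpotent (x i)) ∧ ∀ i j, x i * x j = x j * x i}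

/-- `N_n^r`: the Zariski closure of the set of commuting nilpotent `r`-tuples whose first
entry is regular nilpotent (nilpotent with `x^(n-1) ≠ 0`). -/
noncomputable def Nnr (k : Type*) [Field k] (n r : ℕ) :
    Set (Fin r → Matrix (Fin n) (Fin n) k) :=
  letI := matTupleZariski k n r
  closure {x | x ∈ nilCommTuples k n r ∧ ∀ i : Fin r, (i : ℕ) = 0 → (x i) ^ (n - 1) ≠ 0}

/-- A matrix with linearly independent columns has a nonzero maximal minor. -/
theorem exists_submatrix_det_ne_zero {K σ : Type*} [Field K] [Fintype σ] {m : ℕ}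
    (B : Matrix σ (Fin m) K) (hB : LinearIndependent K B.col) :
    ∃ ρ : Fin m → σ, (B.submatrix ρ id).det ≠ 0 := by
  obtain ⟨κ, a, ha, hs, hli⟩ := exists_linearIndependent' K B.row
  have hrank : B.rank = m := by simpa using hB.rank_matrix
  have htop : Submodule.span K (Set.range B.row) = ⊤ := by
    apply Submodule.eq_top_of_finrank_eq
    rw [← Matrix.rank_eq_finrank_span_row, hrank]; simp
  let b := Module.Basis.mk hli (by rw [hs, htop])
  let e : Fin m ≃ κ := (Pi.basisFun K (Fin m)).indexEquiv b
  refine ⟨a ∘ e, ?_⟩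
  rw [← isUnit_iff_ne_zero, ← Matrix.isUnit_iff_isUnit_det,
    ← Matrix.linearIndependent_rows_iff_isUnit]
  exact hli.comp e e.injective

/-- Over the fraction field of a valuation ring, normalizing at a maximal minor of largest valuation
turns a matrix with independent columns into one with integral entries. -/
theorem exists_echelon_basis {K σ : Type*} [Field K] [Fintype σ] {m : ℕ}
    (O : ValuationSubring K) (B : Matrix σ (Fin m) K) (hB : LinearIndependent K B.col) :
    ∃ (ρ : Fin m → σ) (M : Matrix (Fin m) (Fin m) K), IsUnit M ∧ (B * M).submatrix ρ id = 1 ∧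
      ∀ q j, (B * M) q j ∈ O := by
  obtain ⟨ρ', h⟩ := exists_submatrix_det_ne_zero B hB
  have : Nonempty (Fin m → σ) := ⟨ρ'⟩
  obtain ⟨ρ, hρ⟩ := Finite.exists_max fun ρ : Fin m → σ => O.valuation (B.submatrix ρ id).det
  have h0 : (B.submatrix ρ id).det ≠ 0 := by
    intro h'
    have := hρ ρ'
    simp [h', h] at this
  have hu : IsUnit (B.submatrix ρ id).det := isUnit_iff_ne_zero.2 h0
  refine ⟨ρ, (B.submatrix ρ id)⁻¹, ?_, ?_, fun q j => ?_⟩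
  · rw [Matrix.isUnit_nonsing_inv_iff, Matrix.isUnit_iff_isUnit_det]; exact hu
  · rw [Matrix.submatrix_mul _ _ ρ id id Function.bijective_id, Matrix.submatrix_id_id,
      Matrix.mul_nonsing_inv _ hu]
  · have key : (B * (B.submatrix ρ id)⁻¹) q j =
        (B.submatrix ρ id).det⁻¹ * (B.submatrix (Function.update ρ j q) id).det := by
      have h1 : B.submatrix (Function.update ρ j q) id =
          (B.submatrix ρ id).updateRow j (B q) := by
        ext i l
        by_cases h : i = j
        · subst h; simp
        · simp [h]
      rw [h1, ← Matrix.cramer_transpose_apply, Matrix.cramer_eq_adjugate_mulVec,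
        Matrix.inv_def, ← Matrix.adjugate_transpose]
      simp only [Ring.inverse_eq_inv', Matrix.mul_apply, Matrix.mulVec, dotProduct,
        Matrix.smul_apply, Matrix.transpose_apply, smul_eq_mul, Finset.mul_sum]
      exact Finset.sum_congr rfl fun i _ => by ring
    rw [← O.valuation_le_one_iff, key, map_mul, map_inv₀]
    have hpos : 0 < O.valuation (B.submatrix ρ id).det := by
      simpa [zero_lt_iff] using h0
    rw [inv_mul_le_one₀ hpos]
    exact hρ _

theorem exists_algHom_adjoin {k κ : Type*} [Field k] [IsAlgClosed k] [Field κ] [Algebra k κ]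
    (T : Set κ) (hT : T.Finite) : Nonempty (Algebra.adjoin k T →ₐ[k] k) := by
  have hft : Algebra.FiniteType k (Algebra.adjoin k T) :=
    (Subalgebra.fg_iff_finiteType _).1 ⟨hT.toFinset, by simp⟩
  obtain ⟨I, hI⟩ := Ideal.exists_maximal (Algebra.adjoin k T)
  let := Ideal.Quotient.field I
  have := finite_of_finite_type_of_isJacobsonRing k (Algebra.adjoin k T ⧸ I)
  let e := AlgEquiv.ofBijective (Algebra.ofId k (Algebra.adjoin k T ⧸ I))
    (IsAlgClosed.algebraMap_bijective_of_isIntegral)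
  exact ⟨e.symm.toAlgHom.comp (Ideal.Quotient.mkₐ k I)⟩

/-- A specialization of primes `P ≤ m` is realized by a valuation ring of the residue field
of `P`. -/
theorem exists_valuationSubring_of_prime_le {R : Type*} [CommRing R] (P m : Ideal R) [P.IsPrime]
    [m.IsPrime] (h : P ≤ m) :
    ∃ O : ValuationSubring (FractionRing (R ⧸ P)), ∃ φ : R →+* O,
      (∀ f, (φ f : FractionRing (R ⧸ P)) = 0 ↔ f ∈ P) ∧ ∀ f ∈ m, ¬ IsUnit (φ f) := by
  let ψ : R →+* FractionRing (R ⧸ P) := (algebraMap (R ⧸ P) _).comp (Ideal.Quotient.mk P)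
  have hψ : ∀ f, ψ f = 0 ↔ f ∈ P := fun f => by
    simp [ψ, Ideal.Quotient.eq_zero_iff_mem]
  let L : Localization.AtPrime m →+* FractionRing (R ⧸ P) :=
    IsLocalization.lift (M := m.primeCompl) (g := ψ) fun y =>
      isUnit_iff_ne_zero.2 fun h0 => y.2 (h ((hψ _).1 h0))
  obtain ⟨O, hO, hloc⟩ := IsLocalRing.exists_factor_valuationRing L
  have hL : ∀ f, L (algebraMap R _ f) = ψ f := fun f => IsLocalization.lift_eq _ _
  refine ⟨O, (L.codRestrict O.toSubring hO).comp (algebraMap R _), fun f => ?_, fun f hf hu => ?_⟩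
  · rw [← hψ, ← hL]; rfl
  · have := hloc.map_nonunit _ hu
    rw [IsLocalization.AtPrime.isUnit_to_map_iff _ m] at this
    exact this hf

theorem pow_card_eq_zero_of_isNilpotent {K : Type*} [Field K] {n : ℕ}
    {a : Matrix (Fin n) (Fin n) K} (ha : IsNilpotent a) : a ^ n = 0 := by
  have h : a.charpoly = Polynomial.X ^ n := by
    have := Matrix.isNilpotent_charpoly_sub_pow_of_isNilpotent ha
    simpa [sub_eq_zero] using this.eq_zero
  have := Matrix.aeval_self_charpoly a
  simpa [h] using this

theorem linearIndependent_pow_mulVec {K : Type*} [Field K] {n m : ℕ}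
    {a : Matrix (Fin n) (Fin n) K} (ha : a ^ (m + 1) = 0) {v : Fin n → K}
    (hv : a ^ m *ᵥ v ≠ 0) : LinearIndependent K fun i : Fin (m + 1) => a ^ (i : ℕ) *ᵥ v := by
  rw [Fintype.linearIndependent_iff]
  intro g hg i
  induction i using WellFoundedLT.induction with
  | ind i ih =>
    have h := congrArg (a ^ (m - i) *ᵥ ·) hg
    simp only [Matrix.mulVec_zero, Matrix.mulVec_sum, Matrix.mulVec_smul, Matrix.mulVec_mulVec,
      ← pow_add] at h
    rw [Finset.sum_eq_single i] at h
    · rw [Nat.sub_add_cancel (Nat.lt_succ_iff.1 i.2)] at h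
      exact (smul_eq_zero.1 h).resolve_right hv
    · intro j _ hj
      rcases lt_or_gt_of_ne hj with h' | h'
      · simp [ih j h']
      · rw [pow_eq_zero_of_le (by have : (i : ℕ) < j := h'; omega) ha]
        simp
    · simp

theorem exists_mulVec_ne_zero {K : Type*} [Field K] {n : ℕ}
    {a : Matrix (Fin n) (Fin n) K} (ha : a ≠ 0) : ∃ v, a *ᵥ v ≠ 0 := by
  by_contra! h
  exact ha (Matrix.ext_of_mulVec_single fun i => by rw [h, Matrix.zero_mulVec])

theorem linearIndependent_pow_succ {K : Type*} [Field K] {m : ℕ}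
    {a : Matrix (Fin (m + 1)) (Fin (m + 1)) K} (ha : a ^ (m + 1) = 0) (ham : a ^ m ≠ 0) :
    LinearIndependent K fun j : Fin m => a ^ (j + 1 : ℕ) := by
  obtain ⟨v, hv⟩ := exists_mulVec_ne_zero ham
  have := (linearIndependent_pow_mulVec ha hv).comp _ (Fin.succ_injective m)
  exact LinearIndependent.of_comp ((Matrix.mulVecBilin K K).flip v) this

theorem mem_span_pow_of_commute {K : Type*} [Field K] {m : ℕ}
    {a y : Matrix (Fin (m + 1)) (Fin (m + 1)) K} (ha : a ^ (m + 1) = 0) (ham : a ^ m ≠ 0)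
    (hy : IsNilpotent y) (hya : Commute y a) :
    y ∈ Submodule.span K (Set.range fun j : Fin m => a ^ (j + 1 : ℕ)) := by
  obtain ⟨v, hv⟩ := exists_mulVec_ne_zero ham
  let b := basisOfLinearIndependentOfCardEqFinrank (linearIndependent_pow_mulVec ha hv) (by simp)
  have hb : ∀ i, b i = a ^ (i : ℕ) *ᵥ v := fun i => by simp [b]
  let c := b.repr (y *ᵥ v)
  let p : Matrix (Fin (m + 1)) (Fin (m + 1)) K := ∑ i, c i • a ^ (i : ℕ)
  have hpv : y *ᵥ v = p *ᵥ v := by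
    rw [← b.sum_repr (y *ᵥ v)]
    simp only [p, c, Matrix.sum_mulVec, Matrix.smul_mulVec, hb]
  have hpa : Commute p a := Commute.sum_left _ _ _ fun i _ =>
    ((Commute.refl a).pow_left _).smul_left _
  have hyp : y = p := by
    apply Matrix.toLin'.injective
    refine b.ext fun i => ?_
    rw [hb, Matrix.toLin'_apply, Matrix.toLin'_apply, Matrix.mulVec_mulVec, Matrix.mulVec_mulVec,
      (hya.pow_right i).eq, (hpa.pow_right i).eq, ← Matrix.mulVec_mulVec, ← Matrix.mulVec_mulVec,
      hpv]
  let q : Matrix (Fin (m + 1)) (Fin (m + 1)) K := ∑ j : Fin m, c j.succ • a ^ (j + 1 : ℕ)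
  have hp : p = c 0 • 1 + q := by simp [p, q, Fin.sum_univ_succ]
  have hqa : Commute q a := Commute.sum_left _ _ _ fun i _ =>
    ((Commute.refl a).pow_left _).smul_left _
  have hq : IsNilpotent q := by
    have : q = a * ∑ j : Fin m, c j.succ • a ^ (j : ℕ) := by
      simp [q, Finset.mul_sum, pow_succ']
    rw [this]
    refine Commute.isNilpotent_mul_right ?_ ⟨_, ha⟩
    exact Commute.sum_right _ _ _ fun i _ => ((Commute.refl a).pow_right _).smul_right _
  have hyq : Commute y q := Commute.sum_right _ _ _ fun i _ => (hya.pow_right _).smul_right _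
  have hc : c 0 = 0 := by
    obtain ⟨N, hN⟩ := hyq.isNilpotent_sub hy hq
    rw [hyp, hp, add_sub_cancel_right, smul_pow, one_pow] at hN
    exact eq_zero_of_pow_eq_zero ((smul_eq_zero.1 hN).resolve_right one_ne_zero)
  rw [hyp, hp, hc, zero_smul, zero_add]
  exact Submodule.sum_mem _ fun j _ => Submodule.smul_mem _ _ (Submodule.subset_span ⟨j, rfl⟩)

theorem commute_and_mul_mem_span {K A : Type*} [CommRing K] [Ring A] [Algebra K A] {S : Set A}
    (hS : ∀ y ∈ S, ∀ z ∈ S, y * z = z * y ∧ y * z ∈ Submodule.span K S) {y z : A}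
    (hy : y ∈ Submodule.span K S) (hz : z ∈ Submodule.span K S) :
    y * z = z * y ∧ y * z ∈ Submodule.span K S := by
  induction hy, hz using Submodule.span_induction₂ with
  | mem_mem y z hy hz => exact hS y hy z hz
  | zero_left => simp
  | zero_right => simp
  | add_left x y z _ _ _ h₁ h₂ =>
    exact ⟨by rw [add_mul, mul_add, h₁.1, h₂.1], by rw [add_mul]; exact add_mem h₁.2 h₂.2⟩
  | add_right x y z _ _ _ h₁ h₂ =>
    exact ⟨by rw [add_mul, mul_add, h₁.1, h₂.1], by rw [mul_add]; exact add_mem h₁.2 h₂.2⟩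
  | smul_left r x y _ _ h =>
    exact ⟨by simp [h.1], by rw [smul_mul_assoc]; exact Submodule.smul_mem _ _ h.2⟩
  | smul_right r x y _ _ h =>
    exact ⟨by simp [h.1], by rw [mul_smul_comm]; exact Submodule.smul_mem _ _ h.2⟩

theorem commute_and_mul_mem_span_pow {K A : Type*} [CommRing K] [Ring A] [Algebra K A] {m : ℕ}
    {a y z : A} (ha : a ^ (m + 1) = 0)
    (hy : y ∈ Submodule.span K (Set.range fun j : Fin m => a ^ (j + 1 : ℕ)))
    (hz : z ∈ Submodule.span K (Set.range fun j : Fin m => a ^ (j + 1 : ℕ))) :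
    y * z = z * y ∧ y * z ∈ Submodule.span K (Set.range fun j : Fin m => a ^ (j + 1 : ℕ)) := by
  refine commute_and_mul_mem_span ?_ hy hz
  rintro _ ⟨i, rfl⟩ _ ⟨j, rfl⟩
  simp only [← pow_add]
  refine ⟨by rw [add_comm], ?_⟩
  by_cases h : (i + 1 + (j + 1) : ℕ) ≤ m
  · exact Submodule.subset_span ⟨⟨i + 1 + j, by omega⟩, rfl⟩
  · rw [pow_eq_zero_of_le (by omega) ha]
    exact zero_mem _

/-- `c` is a basis in echelon form (with pivots `ρ`) of a commutative algebra of matrices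
containing `x`, expressed by polynomial identities that make sense over any commutative ring. -/
structure IsEchelonSystem {A : Type*} [CommRing A] {n m r : ℕ} (ρ : Fin m → Fin n × Fin n)
    (c : Fin m → Matrix (Fin n) (Fin n) A) (x : Fin r → Matrix (Fin n) (Fin n) A) : Prop where
  apply_pivot : ∀ j l, c j (ρ l).1 (ρ l).2 = if l = j then 1 else 0
  mul_comm : ∀ i j, c i * c j = c j * c i
  mul_eq : ∀ i j, c i * c j = ∑ l, (c i * c j) (ρ l).1 (ρ l).2 • c l
  eq_sum : ∀ i, x i = ∑ l, x i (ρ l).1 (ρ l).2 • c l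

namespace IsEchelonSystem

variable {A A' : Type*} [CommRing A] [CommRing A'] {n m r : ℕ} {ρ : Fin m → Fin n × Fin n}
  {c : Fin m → Matrix (Fin n) (Fin n) A} {x : Fin r → Matrix (Fin n) (Fin n) A}

theorem map_sum_smul (f : A →+* A') (w : Fin m → A) :
    f.mapMatrix (∑ l, w l • c l) = ∑ l, f (w l) • f.mapMatrix (c l) := by
  rw [map_sum]
  refine Finset.sum_congr rfl fun l _ => ?_
  ext; simp

theorem map (h : IsEchelonSystem ρ c x) (f : A →+* A') :
    IsEchelonSystem ρ (fun j => f.mapMatrix (c j)) (fun i => f.mapMatrix (x i)) where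
  apply_pivot j l := by simp [h.apply_pivot, apply_ite f]
  mul_comm i j := by rw [← map_mul, h.mul_comm, map_mul]
  mul_eq i j := by
    rw [← map_mul]
    conv_lhs => rw [h.mul_eq, map_sum_smul]
    rfl
  eq_sum i := by
    conv_lhs => rw [h.eq_sum, map_sum_smul]
    rfl

theorem of_map (f : A →+* A') (hf : Function.Injective f)
    (h : IsEchelonSystem ρ (fun j => f.mapMatrix (c j)) (fun i => f.mapMatrix (x i))) :
    IsEchelonSystem ρ c x := by
  have hF : Function.Injective (f.mapMatrix : Matrix (Fin n) (Fin n) A →+* _) :=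
    Matrix.map_injective hf
  refine ⟨fun j l => hf ?_, fun i j => hF ?_, fun i j => hF ?_, fun i => hF ?_⟩
  · simpa [apply_ite f] using h.apply_pivot j l
  · rw [map_mul, map_mul, h.mul_comm]
  · rw [map_sum_smul, map_mul]
    conv_lhs => rw [h.mul_eq]
    rw [← map_mul]
    rfl
  · rw [map_sum_smul]
    exact h.eq_sum i

theorem commute_and_mul_mem_span (h : IsEchelonSystem ρ c x) {y z : Matrix (Fin n) (Fin n) A}
    (hy : y ∈ Submodule.span A (Set.range c)) (hz : z ∈ Submodule.span A (Set.range c)) :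
    y * z = z * y ∧ y * z ∈ Submodule.span A (Set.range c) := by
  refine _root_.commute_and_mul_mem_span ?_ hy hz
  rintro _ ⟨i, rfl⟩ _ ⟨j, rfl⟩
  refine ⟨h.mul_comm i j, ?_⟩
  rw [h.mul_eq]
  exact Submodule.sum_mem _ fun l _ => Submodule.smul_mem _ _ (Submodule.subset_span ⟨l, rfl⟩)

theorem linearIndependent (h : IsEchelonSystem ρ c x) : LinearIndependent A c := by
  rw [Fintype.linearIndependent_iff]
  intro g hg i
  have := congrFun (congrFun hg (ρ i).1) (ρ i).2
  simpa [Matrix.sum_apply, h.apply_pivot] using this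

theorem exists_nonUnitalSubalgebra {k : Type*} [Field k] {c : Fin m → Matrix (Fin n) (Fin n) k}
    {x : Fin r → Matrix (Fin n) (Fin n) k} (h : IsEchelonSystem ρ c x) :
    ∃ B : NonUnitalSubalgebra k (Matrix (Fin n) (Fin n) k),
      (∀ a ∈ B, ∀ b ∈ B, a * b = b * a) ∧ Module.finrank k B = m ∧
      NonUnitalAlgebra.adjoin k (Set.range x) ≤ B := by
  refine ⟨{ Submodule.span k (Set.range c) with
    mul_mem' := fun ha hb => (h.commute_and_mul_mem_span ha hb).2 },
    fun a ha b hb => (h.commute_and_mul_mem_span ha hb).1, ?_, ?_⟩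
  · have := finrank_span_eq_card h.linearIndependent
    rw [Fintype.card_fin] at this
    exact this
  · rw [NonUnitalAlgebra.adjoin_le_iff]
    rintro _ ⟨i, rfl⟩
    change x i ∈ Submodule.span k (Set.range c)
    rw [h.eq_sum]
    exact Submodule.sum_mem _ fun l _ => Submodule.smul_mem _ _ (Submodule.subset_span ⟨l, rfl⟩)

end IsEchelonSystem

/-- A commutative algebra of matrices over the fraction field of a valuation ring, spanned by the
powers of a regular nilpotent matrix, has an echelon basis over the valuation ring. -/
theorem exists_isEchelonSystem_valuationSubring {K : Type*} [Field K] {m r : ℕ}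
    (O : ValuationSubring K) (y : Fin r → Matrix (Fin (m + 1)) (Fin (m + 1)) O)
    (a : Matrix (Fin (m + 1)) (Fin (m + 1)) K) (ha : a ^ (m + 1) = 0) (ham : a ^ m ≠ 0)
    (hy : ∀ i, (algebraMap O K).mapMatrix (y i) ∈
      Submodule.span K (Set.range fun j : Fin m => a ^ (j + 1 : ℕ))) :
    ∃ (ρ : Fin m → Fin (m + 1) × Fin (m + 1))
      (c : Fin m → Matrix (Fin (m + 1)) (Fin (m + 1)) O), IsEchelonSystem ρ c y := by
  let B : Matrix (Fin (m + 1) × Fin (m + 1)) (Fin m) K :=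
    Matrix.of fun q j => (a ^ (j + 1 : ℕ)) q.1 q.2
  have hB : LinearIndependent K B.col :=
    (linearIndependent_pow_succ ha ham).map'
      (LinearEquiv.curry K K (Fin (m + 1)) (Fin (m + 1))).symm.toLinearMap (LinearEquiv.ker _)
  obtain ⟨ρ, M, hM, hρ, hO⟩ := exists_echelon_basis O B hB
  let c : Fin m → Matrix (Fin (m + 1)) (Fin (m + 1)) O :=
    fun j => Matrix.of fun p q => ⟨(B * M) (p, q) j, hO _ _⟩
  let c' : Fin m → Matrix (Fin (m + 1)) (Fin (m + 1)) K :=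
    fun j => Matrix.of fun p q => (B * M) (p, q) j
  have hcmem : ∀ j, c' j ∈ Submodule.span K (Set.range fun j : Fin m => a ^ (j + 1 : ℕ)) := by
    intro j
    have : c' j = ∑ i, M i j • a ^ (i + 1 : ℕ) := by
      ext p q
      simp [c', B, Matrix.mul_apply, Matrix.sum_apply, mul_comm]
    rw [this]
    exact Submodule.sum_mem _ fun l _ => Submodule.smul_mem _ _ (Submodule.subset_span ⟨l, rfl⟩)
  have hpiv : ∀ j l, c' j (ρ l).1 (ρ l).2 = if l = j then 1 else 0 := fun j l => by
    have := congrFun (congrFun hρ l) j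
    simpa [c', Matrix.one_apply] using this
  have hsum : ∀ z ∈ Submodule.span K (Set.range fun j : Fin m => a ^ (j + 1 : ℕ)),
      z = ∑ l, z (ρ l).1 (ρ l).2 • c' l := by
    intro z hz
    obtain ⟨w, rfl⟩ := (Submodule.mem_span_range_iff_exists_fun K).1 hz
    have hw : ∑ i, w i • a ^ (i + 1 : ℕ) = ∑ l, (M⁻¹ *ᵥ w) l • c' l := by
      ext p q
      have h1 : (B *ᵥ w) (p, q) = ((B * M) *ᵥ (M⁻¹ *ᵥ w)) (p, q) := by
        rw [Matrix.mulVec_mulVec, Matrix.mul_assoc,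
          Matrix.mul_nonsing_inv _ ((Matrix.isUnit_iff_isUnit_det _).1 hM), Matrix.mul_one]
      simpa [Matrix.mulVec, dotProduct, Matrix.sum_apply, B, c', mul_comm] using h1
    rw [hw]
    refine Finset.sum_congr rfl fun l _ => ?_
    congr 1
    simp [Matrix.sum_apply, hpiv]
  refine ⟨ρ, c, IsEchelonSystem.of_map (algebraMap O K) Subtype.val_injective ?_⟩
  exact ⟨hpiv, fun i j => (commute_and_mul_mem_span_pow ha (hcmem i) (hcmem j)).1,
    fun i j => hsum _ (commute_and_mul_mem_span_pow ha (hcmem i) (hcmem j)).2,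
    fun i => hsum _ (hy i)⟩

/-- An echelon system over an extension field for matrices defined over an algebraically closed
field descends to that field. -/
theorem IsEchelonSystem.exists_of_isAlgClosed {k κ : Type*} [Field k] [IsAlgClosed k] [Field κ]
    [Algebra k κ] {n m r : ℕ} {ρ : Fin m → Fin n × Fin n} {c : Fin m → Matrix (Fin n) (Fin n) κ}
    {x : Fin r → Matrix (Fin n) (Fin n) k}
    (h : IsEchelonSystem ρ c fun i => (algebraMap k κ).mapMatrix (x i)) :
    ∃ c' : Fin m → Matrix (Fin n) (Fin n) k, IsEchelonSystem ρ c' x := by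
  let T : Set κ := Set.range fun q : Fin m × Fin n × Fin n => c q.1 q.2.1 q.2.2
  obtain ⟨f⟩ := exists_algHom_adjoin (k := k) T (Set.finite_range _)
  let d : Fin m → Matrix (Fin n) (Fin n) (Algebra.adjoin k T) :=
    fun j => Matrix.of fun p q => ⟨c j p q, Algebra.subset_adjoin ⟨(j, p, q), rfl⟩⟩
  have hd : IsEchelonSystem ρ d fun i => (algebraMap k (Algebra.adjoin k T)).mapMatrix (x i) :=
    IsEchelonSystem.of_map (algebraMap _ κ) Subtype.val_injective h
  refine ⟨fun j => (f : Algebra.adjoin k T →+* k).mapMatrix (d j), ?_⟩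
  convert hd.map (f : Algebra.adjoin k T →+* k) using 2 with i
  ext p q
  simp

theorem eval_eq_zero_of_mem_closure {k : Type*} [Field k] {n r : ℕ}
    {S : Set (Fin r → Matrix (Fin n) (Fin n) k)} {x : Fin r → Matrix (Fin n) (Fin n) k}
    (hx : x ∈ @closure _ (matTupleZariski k n r) S) (p : MvPolynomial (Fin r × Fin n × Fin n) k)
    (hp : ∀ s ∈ S, eval (fun q => s q.1 q.2.1 q.2.2) p = 0) :
    eval (fun q => x q.1 q.2.1 q.2.2) p = 0 := by
  let := matTupleZariski k n r
  by_contra hne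
  obtain ⟨s, hs, hsS⟩ := mem_closure_iff.1 hx _
    (TopologicalSpace.isOpen_generateFrom_of_mem ⟨p, rfl⟩) hne
  exact hs (hp s hsS)

/-- The `i`-th generic matrix, with entries the coordinate functions on `r`-tuples of matrices. -/
noncomputable def genericMatrix (k : Type*) [Field k] {n r : ℕ} (i : Fin r) :
    Matrix (Fin n) (Fin n) (MvPolynomial (Fin r × Fin n × Fin n) k) :=
  Matrix.of fun a b => X (i, a, b)

theorem eval_mapMatrix_genericMatrix {k : Type*} [Field k] {n r : ℕ}
    (s : Fin r → Matrix (Fin n) (Fin n) k) (i : Fin r) :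
    (eval fun q => s q.1 q.2.1 q.2.2).mapMatrix (genericMatrix k i) = s i := by
  ext a b
  simp [genericMatrix]

theorem exists_prime_of_mem_Nnr {k : Type*} [Field k] {m r : ℕ} (i₀ : Fin r) (hi₀ : (i₀ : ℕ) = 0)
    {x : Fin r → Matrix (Fin (m + 1)) (Fin (m + 1)) k} (hx : x ∈ Nnr k (m + 1) r) :
    ∃ P : Ideal (MvPolynomial (Fin r × Fin (m + 1) × Fin (m + 1)) k), P.IsPrime ∧
      P ≤ RingHom.ker (eval fun q => x q.1 q.2.1 q.2.2) ∧
      (∀ f, (∀ s ∈ nilCommTuples k (m + 1) r, eval (fun q => s q.1 q.2.1 q.2.2) f = 0) → f ∈ P) ∧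
      ∃ a b, (genericMatrix k i₀ ^ m) a b ∉ P := by
  let := matTupleZariski k (m + 1) r
  let e : Fin (m + 1) × Fin (m + 1) → MvPolynomial (Fin r × Fin (m + 1) × Fin (m + 1)) k :=
    fun q => (genericMatrix k i₀ ^ m) q.1 q.2
  have he : ∀ (s : Fin r → Matrix (Fin (m + 1)) (Fin (m + 1)) k) q,
      eval (fun q => s q.1 q.2.1 q.2.2) (e q) = (s i₀ ^ m) q.1 q.2 := fun s q => by
    rw [← eval_mapMatrix_genericMatrix s i₀, ← map_pow]
    rfl
  let S : Fin (m + 1) × Fin (m + 1) → Set (Fin r → Matrix (Fin (m + 1)) (Fin (m + 1)) k) :=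
    fun q => {s | s ∈ nilCommTuples k (m + 1) r ∧ (s i₀ ^ m) q.1 q.2 ≠ 0}
  have hxS : x ∈ closure (⋃ q, S q) := by
    refine closure_mono ?_ hx
    rintro s ⟨hs, hs0⟩
    have h0 : s i₀ ^ m ≠ 0 := hs0 i₀ hi₀
    by_contra! hcon
    refine h0 (Matrix.ext fun a b => ?_)
    by_contra hab
    exact hcon (Set.mem_iUnion.2 ⟨(a, b), hs, hab⟩)
  rw [closure_iUnion_of_finite, Set.mem_iUnion] at hxS
  obtain ⟨q, hq⟩ := hxS
  let I : Ideal (MvPolynomial (Fin r × Fin (m + 1) × Fin (m + 1)) k) :=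
    ⨅ s ∈ S q, RingHom.ker (eval fun q => s q.1 q.2.1 q.2.2)
  have hI : ∀ f, f ∈ I ↔ ∀ s ∈ S q, eval (fun q => s q.1 q.2.1 q.2.2) f = 0 := fun f => by
    simp [I, RingHom.mem_ker]
  have := RingHom.ker_isPrime
    (eval fun q : Fin r × Fin (m + 1) × Fin (m + 1) => x q.1 q.2.1 q.2.2)
  let N := (RingHom.ker
    (eval fun q : Fin r × Fin (m + 1) × Fin (m + 1) => x q.1 q.2.1 q.2.2)).primeCompl ⊔
      Submonoid.powers (e q)
  have hdisj : Disjoint (I : Set (MvPolynomial (Fin r × Fin (m + 1) × Fin (m + 1)) k)) N := by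
    rw [Set.disjoint_left]
    intro f hf hfN
    obtain ⟨g, hg, _, ⟨t, rfl⟩, rfl⟩ := Submonoid.mem_sup.1 hfN
    refine hg (eval_eq_zero_of_mem_closure hq g fun s hs => ?_)
    have := (hI _).1 hf s hs
    rw [map_mul, map_pow, he] at this
    exact (mul_eq_zero.1 this).resolve_right (pow_ne_zero _ hs.2)
  obtain ⟨P, hP, hIP, hPN⟩ := Ideal.exists_le_prime_disjoint I N hdisj
  rw [Set.disjoint_left] at hPN
  refine ⟨P, hP, fun f hf => ?_, fun f hf => hIP ((hI f).2 fun s hs => hf s hs.1), q.1, q.2,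
    fun hmem => hPN hmem ((le_sup_right : _ ≤ N) (Submonoid.mem_powers _))⟩
  by_contra hfx
  exact hPN hf ((le_sup_left : _ ≤ N) hfx)

theorem exists_isEchelonSystem_of_mem_Nnr {k : Type*} [Field k] [IsAlgClosed k] {m r : ℕ}
    (hr : 0 < r) {x : Fin r → Matrix (Fin (m + 1)) (Fin (m + 1)) k} (hx : x ∈ Nnr k (m + 1) r) :
    ∃ (ρ : Fin m → Fin (m + 1) × Fin (m + 1))
      (c : Fin m → Matrix (Fin (m + 1)) (Fin (m + 1)) k), IsEchelonSystem ρ c x := by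
  obtain ⟨P, hP, hPx, hPS, a, b, hab⟩ := exists_prime_of_mem_Nnr ⟨0, hr⟩ rfl hx
  have := RingHom.ker_isPrime
    (eval fun q : Fin r × Fin (m + 1) × Fin (m + 1) => x q.1 q.2.1 q.2.2)
  obtain ⟨O, φ, hφ, hφx⟩ := exists_valuationSubring_of_prime_le P _ hPx
  let K := FractionRing (MvPolynomial (Fin r × Fin (m + 1) × Fin (m + 1)) k ⧸ P)
  let Φ : MvPolynomial (Fin r × Fin (m + 1) × Fin (m + 1)) k →+* K := (algebraMap O K).comp φ
  have hΦ : ∀ f, Φ f = 0 ↔ f ∈ P := hφ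
  let g : Fin r → Matrix (Fin (m + 1)) (Fin (m + 1)) K := fun i => Φ.mapMatrix (genericMatrix k i)
  have hzero : ∀ F : Matrix (Fin (m + 1)) (Fin (m + 1)) (MvPolynomial _ k),
      (∀ s ∈ nilCommTuples k (m + 1) r, (eval fun q => s q.1 q.2.1 q.2.2).mapMatrix F = 0) →
      Φ.mapMatrix F = 0 := fun F hF => Matrix.ext fun a b =>
    (hΦ _).2 (hPS _ fun s hs => congrFun (congrFun (hF s hs) a) b)
  have hnil : ∀ i, g i ^ (m + 1) = 0 := fun i => by
    rw [← map_pow]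
    refine hzero _ fun s hs => ?_
    rw [map_pow, eval_mapMatrix_genericMatrix]
    exact pow_card_eq_zero_of_isNilpotent (hs.1 i)
  have hcomm : ∀ i j, Commute (g i) (g j) := fun i j => by
    rw [Commute, SemiconjBy, ← sub_eq_zero, ← map_mul, ← map_mul, ← map_sub]
    refine hzero _ fun s hs => ?_
    rw [map_sub, map_mul, map_mul, eval_mapMatrix_genericMatrix, eval_mapMatrix_genericMatrix,
      hs.2 i j, sub_self]
  have hreg : g ⟨0, hr⟩ ^ m ≠ 0 := fun h => by
    rw [← map_pow] at h
    exact hab ((hΦ _).1 (congrFun (congrFun h a) b))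
  obtain ⟨ρ, c, hc⟩ := exists_isEchelonSystem_valuationSubring O
    (fun i => φ.mapMatrix (genericMatrix k i)) (g ⟨0, hr⟩) (hnil _) hreg
    fun i => mem_span_pow_of_commute (hnil _) hreg ⟨_, hnil i⟩ (hcomm i _)
  let π := (IsLocalRing.residue O).comp φ
  let : Algebra k (IsLocalRing.ResidueField O) := (π.comp C).toAlgebra
  refine ⟨ρ, IsEchelonSystem.exists_of_isAlgClosed (κ := IsLocalRing.ResidueField O)
    (c := fun j => (IsLocalRing.residue O).mapMatrix (c j)) ?_⟩
  have heq : (fun i => (algebraMap k (IsLocalRing.ResidueField O)).mapMatrix (x i)) =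
      fun i => (IsLocalRing.residue O).mapMatrix (φ.mapMatrix (genericMatrix k i)) := by
    ext i p q
    change π (C (x i p q)) = π (X (i, p, q))
    rw [← sub_eq_zero, ← map_sub]
    refine (IsLocalRing.residue_eq_zero_iff _).2 ((IsLocalRing.mem_maximalIdeal _).2 (hφx _ ?_))
    simp [RingHom.mem_ker]
  rw [heq]
  exact hc.map (IsLocalRing.residue O)

/-- Let `n, r ≥ 2` and `(x₁, …, x_r) ∈ N_n^r`. Then the non-unital `k`-subalgebra
generated by `x₁, …, x_r` is contained in a commutative non-unital subalgebra of
dimension `n - 1`; in particular its dimension is at most `n - 1`. -/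
theorem adjoin_le_commutative_of_mem_Nnr (k : Type*) [Field k] [IsAlgClosed k]
    (n r : ℕ) (hn : 2 ≤ n) (hr : 2 ≤ r)
    (x : Fin r → Matrix (Fin n) (Fin n) k) (hx : x ∈ Nnr k n r) :
    (∃ B : NonUnitalSubalgebra k (Matrix (Fin n) (Fin n) k),
        (∀ a ∈ B, ∀ b ∈ B, a * b = b * a) ∧ Module.finrank k B = n - 1 ∧
        NonUnitalAlgebra.adjoin k (Set.range x) ≤ B) ∧
      Module.finrank k (NonUnitalAlgebra.adjoin k (Set.range x)) ≤ n - 1 := by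
  obtain ⟨m, rfl⟩ : ∃ m, n = m + 1 := ⟨n - 1, by omega⟩
  obtain ⟨ρ, c, hc⟩ := exists_isEchelonSystem_of_mem_Nnr (by omega) hx
  obtain ⟨B, hcomm, hrank, hle⟩ := hc.exists_nonUnitalSubalgebra
  refine ⟨⟨B, hcomm, hrank, hle⟩, ?_⟩
  refine le_of_le_of_eq ?_ hrank
  exact Submodule.finrank_mono (s := (NonUnitalAlgebra.adjoin k (Set.range x)).toSubmodule)
    (t := B.toSubmodule) hle
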